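/- Let N ≥ 1, m = 1, q ∈ (0,1) and σ > 0 arbitrary. Let u_0 ∈ L^∞(ℝ^N) be non-negative and let u be a non-negative weak solution of the semilinear equation ∂_t u = Δu − |x|^σ u^q with u(0) = u_0. Assume there exists R > 0 such that for a.e. t > 0 one has u(t,x) = 0 for a.e. x with |x| ≥ R. Then u vanishes in finite time: there exists T_e ∈ (0,∞) such that u(t,x) = 0 for a.e. x ∈ ℝ^N and a.e. t ≥ T_e. -/

import Mathlib

open MeasureTheory Set

noncomputable section

/-- A non-negative weak solution of `∂ₜ u = Δ(uᵐ) − w(x) u^q` on `(0,∞)×ℝᴺ`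
with initial condition `u₀`, in the sense of Definition 1.1 of the paper:
`u` is a bounded non-negative measurable function, and there is a measurable
vector field `g` (the weak spatial gradient of `uᵐ`) which is locally square
integrable on `(0,T)×ℝᴺ`, satisfies the weak derivative identity against test
functions in `C_c^1((0,T)×ℝᴺ)`, and satisfies the weak formulation of the
equation against test functions in `C_c^1([0,T)×ℝᴺ)`. -/
def IsWeakSolution (N : ℕ) (m q : ℝ) (w : EuclideanSpace ℝ (Fin N) → ℝ)
    (u0 : EuclideanSpace ℝ (Fin N) → ℝ)
    (u : ℝ → EuclideanSpace ℝ (Fin N) → ℝ) : Prop :=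
  Measurable (Function.uncurry u) ∧
  (∀ t x, 0 ≤ u t x) ∧
  (∃ C : ℝ, ∀ t x, u t x ≤ C) ∧
  ∃ g : ℝ → EuclideanSpace ℝ (Fin N) → EuclideanSpace ℝ (Fin N),
    Measurable (Function.uncurry g) ∧
    ∀ T > (0:ℝ),
      (∀ K : Set (EuclideanSpace ℝ (Fin N)), IsCompact K →
        ∫⁻ s in Ioo (0:ℝ) T, ∫⁻ x in K, ENNReal.ofReal (‖g s x‖ ^ 2) < ⊤) ∧
      (∀ ζ : ℝ × EuclideanSpace ℝ (Fin N) → ℝ, ContDiff ℝ 1 ζ →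
        HasCompactSupport ζ → (∀ s x, s ∉ Ioo (0:ℝ) T → ζ (s, x) = 0) →
        ∀ i : Fin N,
          (∫ s in Ioo (0:ℝ) T, ∫ x,
              (u s x) ^ m * fderiv ℝ ζ (s, x) (0, EuclideanSpace.single i 1))
            = - ∫ s in Ioo (0:ℝ) T, ∫ x, g s x i * ζ (s, x)) ∧
      (∀ ζ : ℝ × EuclideanSpace ℝ (Fin N) → ℝ, ContDiff ℝ 1 ζ →
        HasCompactSupport ζ → (∀ s x, T ≤ s → ζ (s, x) = 0) →
        ∫ s in Ioo (0:ℝ) T, ∫ x,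
            ((u0 x - u s x) * fderiv ℝ ζ (s, x) (1, 0)
              + fderiv ℝ ζ (s, x) (0, g s x)
              + w x * (u s x) ^ q * ζ (s, x)) = 0)

/-- `u₀` is a non-negative function in `L^∞(ℝᴺ)`. -/
def IsBddNonneg (N : ℕ) (u0 : EuclideanSpace ℝ (Fin N) → ℝ) : Prop :=
  Measurable u0 ∧ (∀ x, 0 ≤ u0 x) ∧ ∃ C : ℝ, ∀ x, u0 x ≤ C

/-- The solution `u` vanishes in finite time. -/
def VanishesInFiniteTime (N : ℕ) (u : ℝ → EuclideanSpace ℝ (Fin N) → ℝ) : Prop :=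
  ∃ Te : ℝ, 0 < Te ∧ ∀ᵐ t : ℝ, Te ≤ t → ∀ᵐ x : EuclideanSpace ℝ (Fin N), u t x = 0

/-- The support of `u(t)` is contained in `B(0,R)` for a.e. `t > 0`. -/
def SupportLocalized (N : ℕ) (R : ℝ) (u : ℝ → EuclideanSpace ℝ (Fin N) → ℝ) : Prop :=
  ∀ᵐ t : ℝ, 0 < t → ∀ᵐ x : EuclideanSpace ℝ (Fin N), R ≤ ‖x‖ → u t x = 0

namespace FTE
open Filter Topology Convolution

lemma second_deriv_nonpos {h h' : ℝ → ℝ} {c : ℝ} (h1 : ∀ r, HasDerivAt h (h' r) r)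
    (h2 : HasDerivAt h' c 0) (hm : IsLocalMax h 0) : c ≤ 0 := by
  by_contra hc
  push Not at hc
  have hd : deriv h = h' := funext fun r => (h1 r).deriv
  have hmin : IsLocalMin h 0 := by
    apply isLocalMin_of_deriv_deriv_pos
    · rw [hd, h2.deriv]; exact hc
    · exact hm.deriv_eq_zero
    · exact (h1 0).continuousAt
  have heq : h =ᶠ[𝓝 0] fun _ => h 0 := by
    filter_upwards [hmin, hm] with r a b using le_antisymm b a
  have : h' =ᶠ[𝓝 0] fun _ => 0 := by
    have := heq.deriv
    rw [hd] at this
    simpa using this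
  have h3 := (h2.congr_of_eventuallyEq this.symm)
  have := h3.unique (hasDerivAt_const 0 (0:ℝ))
  linarith

section conv
set_option linter.unusedSectionVars false
variable {G : Type*} [NormedAddCommGroup G] [NormedSpace ℝ G] [MeasurableSpace G] [BorelSpace G]
  (μ : Measure G) [SFinite μ] [μ.IsAddLeftInvariant]

/-- plain convolution -/
def cv (u ρ : G → ℝ) (p : G) : ℝ := ∫ z, u z * ρ (p - z) ∂μ

/-- directional derivative -/
def dd (v : G) (ρ : G → ℝ) : G → ℝ := fun p => fderiv ℝ ρ p v

lemma dd_contDiff {ρ : G → ℝ} (hρ : ContDiff ℝ (⊤ : ℕ∞) ρ) (v : G) :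
    ContDiff ℝ (⊤ : ℕ∞) (dd v ρ) :=
  (hρ.fderiv_right (m := (⊤ : ℕ∞)) (by simp)).clm_apply contDiff_const

lemma dd_supp {ρ : G → ℝ} (hρ : HasCompactSupport ρ) (v : G) :
    HasCompactSupport (dd v ρ) := hρ.fderiv_apply (𝕜 := ℝ) v

lemma cv_hasDerivAt {u ρ : G → ℝ} (hu : LocallyIntegrable u μ) (hρ : ContDiff ℝ (⊤ : ℕ∞) ρ)
    (hs : HasCompactSupport ρ) (p v : G) (r : ℝ) :
    HasDerivAt (fun r : ℝ => cv μ u ρ (p + r • v)) (cv μ u (dd v ρ) (p + r • v)) r := by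
  have h1 := hs.hasFDerivAt_convolution_right (ContinuousLinearMap.mul ℝ ℝ) hu
    (hρ.of_le (by exact_mod_cast le_top)) (p + r • v)
  have h2 : HasDerivAt (fun r : ℝ => p + r • v) v r := by
    simpa using ((hasDerivAt_id r).smul_const v).const_add p
  have h3 := h1.comp_hasDerivAt r h2
  rw [convolution_precompR_apply _ hu (hs.fderiv (𝕜 := ℝ))
    (hρ.continuous_fderiv (by simp))] at h3
  exact h3

lemma cv_continuous {u ρ : G → ℝ} (hu : LocallyIntegrable u μ) (hρ : ContDiff ℝ (⊤ : ℕ∞) ρ)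
    (hs : HasCompactSupport ρ) : Continuous (cv μ u ρ) := by
  refine continuous_iff_continuousAt.2 fun p => ?_
  exact (hs.hasFDerivAt_convolution_right (ContinuousLinearMap.mul ℝ ℝ) hu
    (hρ.of_le (by exact_mod_cast le_top)) p).continuousAt

lemma dd_comp_sub {ρ : G → ℝ} (hρ : ContDiff ℝ (⊤ : ℕ∞) ρ) (p v : G) :
    dd v (fun z => ρ (p - z)) = fun z => - dd v ρ (p - z) := by
  ext z
  have h1 : HasFDerivAt ρ (fderiv ℝ ρ (p - z)) (p - z) :=
    (hρ.differentiable (by simp) _).hasFDerivAt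
  have h2 : HasFDerivAt (fun z : G => p - z) (-(ContinuousLinearMap.id ℝ G)) z :=
    (hasFDerivAt_id z).const_sub p
  have := (h1.comp z h2).fderiv
  simp only [dd]
  change fderiv ℝ (ρ ∘ fun z => p - z) z v = _
  rw [this]; simp

lemma dd_dd_comp_sub {ρ : G → ℝ} (hρ : ContDiff ℝ (⊤ : ℕ∞) ρ) (p v : G) :
    dd v (dd v (fun z => ρ (p - z))) = fun z => dd v (dd v ρ) (p - z) := by
  rw [dd_comp_sub hρ]
  have h := dd_comp_sub (dd_contDiff hρ v) p v
  ext z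
  have : dd v (fun z => - dd v ρ (p - z)) z = - dd v (fun z => dd v ρ (p - z)) z := by
    simp [dd]
  rw [this, h]; simp
end conv

/-- the algebraic inequality for the barrier -/
lemma barrier_ineq {k z E S n : ℝ} (hk : 0 < k) (hz : 0 ≤ z) (hE : E = Real.exp (-(k * z)))
    (hn : 1 ≤ n) (hS : 0 ≤ S) (hS2 : 1 / 8 ≤ k * z → 5 * k ≤ S) :
    k / 2 * (1 + E) + (4 * k ^ 2 * z - 2 * k * n) * E ≤ S * (1 + E) := by
  have hEpos : 0 < E := hE ▸ Real.exp_pos _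
  have hkz : 0 ≤ k * z := by positivity
  have hE1 : E ≤ 1 := by rw [hE]; exact Real.exp_le_one_iff.2 (by linarith)
  have hE2 : 1 - k * z ≤ E := by rw [hE]; linarith [Real.add_one_le_exp (-(k * z))]
  have hE3 : k * z * E ≤ 1 := by
    have h : k * z ≤ Real.exp (k * z) := by linarith [Real.add_one_le_exp (k * z)]
    rw [hE, Real.exp_neg, ← div_eq_mul_inv, div_le_one (Real.exp_pos _)]; exact h
  rcases le_total (1 / 8) (k * z) with h | h
  · have h5 := hS2 h
    have : k * (k * z * E) ≤ k * 1 := by gcongr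
    have : 0 ≤ k * n * E := by positivity
    have : k * E ≤ k * 1 := by gcongr
    have : 0 ≤ S * E := by positivity
    nlinarith
  · have : 0 ≤ S * (1 + E) := by positivity
    have h1 : k * (k * z * E) ≤ k * (1 / 8 * E) := by gcongr
    have h2 : k * 1 * E ≤ k * n * E := by gcongr
    have h3 : k * (7 / 8) ≤ k * E := by gcongr; linarith
    nlinarith

lemma barrier_d1 {N : ℕ} (k : ℝ) (x : EuclideanSpace ℝ (Fin N)) (i : Fin N) (r : ℝ) :
    HasDerivAt (fun r : ℝ => Real.exp (-(k * ‖x + r • EuclideanSpace.single i (1:ℝ)‖ ^ 2)))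
      (-(2 * k * (x i + r)) * Real.exp (-(k * (‖x‖ ^ 2 + 2 * r * x i + r ^ 2)))) r := by
  have h : ∀ r : ℝ, ‖x + r • EuclideanSpace.single i (1:ℝ)‖ ^ 2 = ‖x‖ ^ 2 + 2 * r * x i + r ^ 2 := by
    intro r
    rw [norm_add_sq_real, norm_smul, inner_smul_right, EuclideanSpace.inner_single_right]
    simp; ring
  simp only [h]
  have h1 : HasDerivAt (fun r : ℝ => -(k * (‖x‖ ^ 2 + 2 * r * x i + r ^ 2)))
      (-(k * (2 * x i + 2 * r))) r := by
    have a : HasDerivAt (fun r : ℝ => 2 * r * x i) (2 * x i) r := by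
      simpa using ((hasDerivAt_id r).const_mul 2).mul_const (x i)
    have b : HasDerivAt (fun r : ℝ => r ^ 2) (2 * r) r := by simpa using hasDerivAt_pow 2 r
    exact (((a.const_add _).add b).const_mul k).neg
  convert h1.exp using 1
  ring

lemma barrier_d2 {N : ℕ} (k : ℝ) (x : EuclideanSpace ℝ (Fin N)) (i : Fin N) :
    HasDerivAt (fun r : ℝ => -(2 * k * (x i + r)) * Real.exp (-(k * (‖x‖ ^ 2 + 2 * r * x i + r ^ 2))))
      ((4 * k ^ 2 * (x i) ^ 2 - 2 * k) * Real.exp (-(k * ‖x‖ ^ 2))) 0 := by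
  have h1 : HasDerivAt (fun r : ℝ => -(k * (‖x‖ ^ 2 + 2 * r * x i + r ^ 2)))
      (-(k * (2 * x i + 2 * 0))) 0 := by
    have a : HasDerivAt (fun r : ℝ => 2 * r * x i) (2 * x i) 0 := by
      simpa using ((hasDerivAt_id (0:ℝ)).const_mul 2).mul_const (x i)
    have b : HasDerivAt (fun r : ℝ => r ^ 2) (2 * 0) (0:ℝ) := by
      simpa using hasDerivAt_pow 2 (0:ℝ)
    exact (((a.const_add _).add b).const_mul k).neg
  have h2 : HasDerivAt (fun r : ℝ => -(2 * k * (x i + r))) (-(2 * k * 1)) 0 :=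
    (((hasDerivAt_id (0:ℝ)).const_add (x i)).const_mul (2 * k)).neg
  refine (h2.mul h1.exp).congr_deriv ?_
  simp
  ring

lemma comparison {N : ℕ} {U Ut : ℝ × EuclideanSpace ℝ (Fin N) → ℝ}
    {Ui Uii : Fin N → ℝ × EuclideanSpace ℝ (Fin N) → ℝ} {S : EuclideanSpace ℝ (Fin N) → ℝ}
    {M k t1 R : ℝ} (hM : 0 < M) (hUc : Continuous U)
    (hUt : ∀ p, HasDerivAt (fun r : ℝ => U (p + r • ((1:ℝ), (0 : EuclideanSpace ℝ (Fin N))))) (Ut p) 0)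
    (hU1 : ∀ i p (r : ℝ), HasDerivAt (fun r : ℝ => U (p + r • ((0:ℝ), EuclideanSpace.single i (1:ℝ))))
      (Ui i (p + r • ((0:ℝ), EuclideanSpace.single i (1:ℝ)))) r)
    (hU2 : ∀ i p, HasDerivAt (fun r : ℝ => Ui i (p + r • ((0:ℝ), EuclideanSpace.single i (1:ℝ))))
      (Uii i p) 0)
    (hUM : ∀ t x, t1 ≤ t → U (t, x) ≤ M)
    (hU0 : ∀ t x, t1 ≤ t → R ≤ ‖x‖ → U (t, x) = 0)
    (hS : ∀ x, 0 ≤ S x)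
    (hpde : ∀ t x, t1 ≤ t → Ut (t, x) - ∑ i, Uii i (t, x) ≤ - (S x * U (t, x)))
    (hbar : ∀ x : EuclideanSpace ℝ (Fin N), k / 2 * (1 + Real.exp (-(k * ‖x‖ ^ 2)))
      + (4 * k ^ 2 * ‖x‖ ^ 2 - 2 * k * N) * Real.exp (-(k * ‖x‖ ^ 2))
        ≤ S x * (1 + Real.exp (-(k * ‖x‖ ^ 2))))
    (t : ℝ) (ht : t1 ≤ t) (x : EuclideanSpace ℝ (Fin N)) :
    U (t, x) ≤ M * Real.exp (-(k / 2 * (t - t1))) * (1 + Real.exp (-(k * ‖x‖ ^ 2))) := by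
  set V : ℝ × EuclideanSpace ℝ (Fin N) → ℝ := fun p =>
    M * Real.exp (-(k / 2 * (p.1 - t1))) * (1 + Real.exp (-(k * ‖p.2‖ ^ 2))) with hV
  have hVpos : ∀ p, 0 < V p := fun p => by positivity
  have key : ∀ η > 0, U (t, x) ≤ V (t, x) + η * (t - t1) := by
    intro η hη
    by_contra hcon
    push Not at hcon
    set W : ℝ × EuclideanSpace ℝ (Fin N) → ℝ := fun p => U p - V p - η * (p.1 - t1) with hW
    have hWc : Continuous W := by
      simp only [hW, hV]; fun_prop
    have hW0 : 0 < W (t, x) := by simp only [hW]; linarith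
    have hout : ∀ p : ℝ × EuclideanSpace ℝ (Fin N), t1 ≤ p.1 → 0 < W p →
        t1 < p.1 ∧ p.1 < t1 + M / η ∧ ‖p.2‖ < R := by
      rintro ⟨a, y⟩ ha hp
      simp only at ha
      refine ⟨?_, ?_, ?_⟩
      · by_contra h
        have : a = t1 := le_antisymm (not_lt.1 h) ha
        subst this
        have h1 := hUM a y le_rfl
        simp only [hW, hV] at hp
        simp at hp
        have : 0 < M * Real.exp (-(k * ‖y‖ ^ 2)) := by positivity
        nlinarith
      · by_contra h
        simp only [not_lt] at h
        have h1 := hUM a y ha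
        have h2 := hVpos (a, y)
        have h3 : M ≤ η * (a - t1) := by
          have : M / η ≤ a - t1 := by linarith
          rw [div_le_iff₀ hη] at this; linarith
        simp only [hW] at hp
        linarith
      · by_contra h
        simp only [not_lt] at h
        have h1 := hU0 a y ha h
        have h2 := hVpos (a, y)
        have : 0 ≤ η * (a - t1) := mul_nonneg hη.le (by linarith)
        simp only [hW] at hp
        linarith
    have htx := hout (t, x) ht hW0
    obtain ⟨p, hpK, hpmax⟩ := (isCompact_Icc.prod (isCompact_closedBall (0 : EuclideanSpace ℝ (Fin N)) R)
      : IsCompact (Icc t1 (t1 + M / η) ×ˢ Metric.closedBall (0 : EuclideanSpace ℝ (Fin N)) R)).exists_isMaxOn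
        ⟨(t, x), ⟨⟨htx.1.le, htx.2.1.le⟩, by simpa using htx.2.2.le⟩⟩ hWc.continuousOn
    have hpW : 0 < W p := lt_of_lt_of_le hW0
      (hpmax (show (t, x) ∈ _ from ⟨⟨htx.1.le, htx.2.1.le⟩, by simpa using htx.2.2.le⟩))
    obtain ⟨q1, q2, q3⟩ := hout p hpK.1.1 hpW
    have hloc : IsLocalMax W p := by
      refine hpmax.isLocalMax ?_
      refine prod_mem_nhds (Icc_mem_nhds q1 q2) ?_
      exact Metric.closedBall_mem_nhds_of_mem (by simpa using q3)
    have hline : ∀ v : ℝ × EuclideanSpace ℝ (Fin N), IsLocalMax (fun r : ℝ => W (p + r • v)) 0 := by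
      intro v
      have hc : ContinuousAt (fun r : ℝ => p + r • v) 0 := by fun_prop
      have hc' : Tendsto (fun r : ℝ => p + r • v) (𝓝 0) (𝓝 p) := by
        simpa [ContinuousAt] using hc
      have := hc'.eventually hloc
      simpa [IsLocalMax, IsMaxFilter] using this
    set E := Real.exp (-(k * ‖p.2‖ ^ 2)) with hE
    set D := M * Real.exp (-(k / 2 * (p.1 - t1))) with hD
    have hDpos : 0 < D := by positivity
    -- time derivative
    have htime : Ut p - (-(k / 2) * D * (1 + E)) - η = 0 := by
      have hl := hline ((1:ℝ), 0)
      have hV' : HasDerivAt (fun r : ℝ => V (p + r • ((1:ℝ), (0 : EuclideanSpace ℝ (Fin N)))))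
          (-(k / 2) * D * (1 + E)) 0 := by
        have e : (fun r : ℝ => V (p + r • ((1:ℝ), (0 : EuclideanSpace ℝ (Fin N))))) = fun r =>
            M * Real.exp (-(k / 2 * (p.1 + r - t1))) * (1 + E) := by
          ext r; simp [hV, hE]
        rw [e]
        have a : HasDerivAt (fun r : ℝ => -(k / 2 * (p.1 + r - t1))) (-(k / 2 * 1)) 0 :=
          ((((hasDerivAt_id (0:ℝ)).const_add p.1).sub_const t1).const_mul (k / 2)).neg
        refine ((a.exp.const_mul M).mul_const (1 + E)).congr_deriv ?_
        simp only [hD, add_zero, mul_one]; ring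
      have hη' : HasDerivAt (fun r : ℝ => η * ((p + r • ((1:ℝ), (0 : EuclideanSpace ℝ (Fin N)))).1 - t1))
          (η * 1) 0 := by
        have e : (fun r : ℝ => η * ((p + r • ((1:ℝ), (0 : EuclideanSpace ℝ (Fin N)))).1 - t1))
          = fun r => η * (p.1 + r - t1) := by ext r; simp
        rw [e]
        exact (((hasDerivAt_id (0:ℝ)).const_add p.1).sub_const t1).const_mul η
      have hd := ((hUt p).sub hV').sub hη'
      have := hl.hasDerivAt_eq_zero hd
      linarith
    have hspace : ∀ i, Uii i p - D * ((4 * k ^ 2 * (p.2 i) ^ 2 - 2 * k) * E) ≤ 0 := by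
      intro i
      have hl := hline ((0:ℝ), EuclideanSpace.single i (1:ℝ))
      have e : (fun r : ℝ => W (p + r • ((0:ℝ), EuclideanSpace.single i (1:ℝ)))) = fun r : ℝ =>
          U (p + r • ((0:ℝ), EuclideanSpace.single i (1:ℝ)))
           - D * (1 + Real.exp (-(k * ‖p.2 + r • EuclideanSpace.single i (1:ℝ)‖ ^ 2)))
           - η * (p.1 - t1) := by
        ext r; simp [hW, hV, hD]
      rw [e] at hl
      refine second_deriv_nonpos (h' := fun r => Ui i (p + r • ((0:ℝ), EuclideanSpace.single i (1:ℝ)))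
          - D * (-(2 * k * (p.2 i + r)) * Real.exp (-(k * (‖p.2‖ ^ 2 + 2 * r * p.2 i + r ^ 2)))))
          (fun r => ?_) ?_ hl
      · exact ((hU1 i p r).sub (((barrier_d1 k p.2 i r).const_add 1).const_mul D)).sub_const _
      · exact (hU2 i p).sub ((barrier_d2 k p.2 i).const_mul D)
    have hsum : ∑ i, Uii i p ≤ D * ((4 * k ^ 2 * ‖p.2‖ ^ 2 - 2 * k * N) * E) := by
      calc ∑ i, Uii i p ≤ ∑ i, D * ((4 * k ^ 2 * (p.2 i) ^ 2 - 2 * k) * E) :=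
            Finset.sum_le_sum fun i _ => by linarith [hspace i]
        _ = _ := by
            rw [EuclideanSpace.norm_sq_eq, ← Finset.mul_sum, ← Finset.sum_mul,
              Finset.sum_sub_distrib, ← Finset.mul_sum]
            simp; left; left; ring
    have h1 := hpde p.1 p.2 q1.le
    have h2 := mul_le_mul_of_nonneg_left (hbar p.2) hDpos.le
    have h3 : V p ≤ U p := by
      have : 0 ≤ η * (p.1 - t1) := mul_nonneg hη.le (by linarith)
      simp only [hW] at hpW; linarith
    have h4 := mul_le_mul_of_nonneg_left h3 (hS p.2)
    have h5 : V p = D * (1 + E) := rfl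
    simp only [Prod.mk.eta] at h1
    rw [h5] at h4
    simp only [← hE] at h2
    nlinarith
  refine le_of_forall_pos_le_add fun ε hε => ?_
  rcases ht.eq_or_lt with h | h
  · have := key 1 one_pos
    have h0 : t - t1 = 0 := by linarith
    rw [h0] at this
    have h1 : V (t, x) = M * Real.exp (-(k / 2 * (t - t1))) * (1 + Real.exp (-(k * ‖x‖ ^ 2))) := rfl
    linarith
  · have := key (ε / (t - t1)) (div_pos hε (by linarith))
    rwa [div_mul_cancel₀ _ (by linarith : t - t1 ≠ 0)] at this

lemma iter_eq {N : ℕ} {T : ℝ} {F : ℝ × EuclideanSpace ℝ (Fin N) → ℝ} (hF : Integrable F)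
    (h0 : ∀ z, z.1 ∉ Ioo (0:ℝ) T → F z = 0) :
    ∫ s in Ioo (0:ℝ) T, ∫ x, F (s, x) = ∫ z, F z := by
  rw [setIntegral_eq_integral_of_forall_compl_eq_zero, Measure.volume_eq_prod, integral_prod]
  · exact hF
  · intro s hs
    simp [h0 (s, _) hs]

lemma g_integrable {N : ℕ} {T : ℝ} {g : ℝ → EuclideanSpace ℝ (Fin N) → EuclideanSpace ℝ (Fin N)}
    (hg : Measurable (Function.uncurry g))
    (hg2 : ∀ K : Set (EuclideanSpace ℝ (Fin N)), IsCompact K →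
        ∫⁻ s in Ioo (0:ℝ) T, ∫⁻ x in K, ENNReal.ofReal (‖g s x‖ ^ 2) < ⊤)
    {η : ℝ × EuclideanSpace ℝ (Fin N) → ℝ} (hη : Continuous η) (hc : HasCompactSupport η)
    (h0 : ∀ z, z.1 ∉ Ioo (0:ℝ) T → η z = 0) (i : Fin N) :
    Integrable (fun z : ℝ × EuclideanSpace ℝ (Fin N) => g z.1 z.2 i * η z) := by
  set K : Set (EuclideanSpace ℝ (Fin N)) := Prod.snd '' tsupport η with hK
  have hKc : IsCompact K := hc.isCompact.image continuous_snd
  set A : Set (ℝ × EuclideanSpace ℝ (Fin N)) := Ioo (0:ℝ) T ×ˢ K with hA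
  have hAm : (volume : Measure (ℝ × EuclideanSpace ℝ (Fin N))).restrict A
      = (volume.restrict (Ioo (0:ℝ) T)).prod (volume.restrict K) := by
    rw [Measure.volume_eq_prod, Measure.prod_restrict]
  have hAfin : volume A < ⊤ := by
    rw [Measure.volume_eq_prod, Measure.prod_prod]
    exact ENNReal.mul_lt_top (by simp) hKc.measure_lt_top
  have hgm : Measurable (fun z : ℝ × EuclideanSpace ℝ (Fin N) => g z.1 z.2) := hg
  have hgi : Measurable (fun z : ℝ × EuclideanSpace ℝ (Fin N) => g z.1 z.2 i) := by fun_prop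
  have hsq : IntegrableOn (fun z : ℝ × EuclideanSpace ℝ (Fin N) => ‖g z.1 z.2‖ ^ 2) A := by
    refine ⟨(hgm.norm.pow_const 2).aestronglyMeasurable, ?_⟩
    rw [hasFiniteIntegral_iff_ofReal (Eventually.of_forall fun z => by positivity), hAm,
      lintegral_prod _ (by fun_prop)]
    exact hg2 K hKc
  have h1 : IntegrableOn (fun z : ℝ × EuclideanSpace ℝ (Fin N) => g z.1 z.2 i) A := by
    have : IntegrableOn (fun z : ℝ × EuclideanSpace ℝ (Fin N) => ‖g z.1 z.2‖ ^ 2 + 1) A :=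
      hsq.add (integrableOn_const (hs := hAfin.ne) )
    refine Integrable.mono' this hgi.aestronglyMeasurable (Eventually.of_forall fun z => ?_)
    have := PiLp.norm_apply_le (g z.1 z.2) i
    nlinarith [sq_nonneg (‖g z.1 z.2‖ - 1), norm_nonneg (g z.1 z.2)]
  obtain ⟨C, hC⟩ := hc.exists_bound_of_continuous hη
  have h2 : IntegrableOn (fun z : ℝ × EuclideanSpace ℝ (Fin N) => g z.1 z.2 i * η z) A :=
    Integrable.mul_bdd h1 hη.aestronglyMeasurable (Eventually.of_forall hC)
  refine (integrableOn_iff_integrable_of_support_subset ?_).1 h2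
  intro z hz
  have hz' : η z ≠ 0 := fun h => hz (by simp [h])
  refine ⟨?_, ⟨z, subset_tsupport _ hz', rfl⟩⟩
  by_contra h
  exact hz' (h0 z h)

lemma bdd_integrable {G : Type*} [TopologicalSpace G] [MeasurableSpace G] [OpensMeasurableSpace G]
    {μ : Measure G} [IsFiniteMeasureOnCompacts μ]
    {f η : G → ℝ} {C : ℝ} (hf : Measurable f) (hb : ∀ z, |f z| ≤ C) (hη : Continuous η)
    (hc : HasCompactSupport η) : Integrable (fun z => f z * η z) μ :=
  (hη.integrable_of_hasCompactSupport hc).bdd_mul hf.aestronglyMeasurable (Eventually.of_forall hb)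

lemma weak_to_dist {N : ℕ} {q : ℝ} {w u0 : EuclideanSpace ℝ (Fin N) → ℝ}
    {u : ℝ → EuclideanSpace ℝ (Fin N) → ℝ} (hq0 : 0 < q) (hw : Continuous w)
    (hu0 : IsBddNonneg N u0) (hu : IsWeakSolution N 1 q w u0 u)
    {T : ℝ} (hT : 0 < T) {ζ : ℝ × EuclideanSpace ℝ (Fin N) → ℝ} (hζ : ContDiff ℝ (⊤ : ℕ∞) ζ)
    (hc : HasCompactSupport ζ) (hs : tsupport ζ ⊆ {z | z.1 ∈ Ioo (0:ℝ) T}) :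
    (∫ z, u z.1 z.2 * dd ((1:ℝ), (0 : EuclideanSpace ℝ (Fin N))) ζ z) +
      ∑ i, (∫ z, u z.1 z.2 * dd ((0:ℝ), EuclideanSpace.single i (1:ℝ))
        (dd ((0:ℝ), EuclideanSpace.single i (1:ℝ)) ζ) z)
      = ∫ z, w z.2 * (u z.1 z.2) ^ q * ζ z := by
  obtain ⟨hum, hun, ⟨C, hC⟩, g, hg, H⟩ := hu
  obtain ⟨hu0m, hu0n, C0, hC0⟩ := hu0
  obtain ⟨hg2, H1, H2⟩ := H T hT
  have hum' : Measurable (fun z : ℝ × EuclideanSpace ℝ (Fin N) => u z.1 z.2) := hum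
  have hζt := dd_contDiff hζ ((1:ℝ), (0 : EuclideanSpace ℝ (Fin N)))
  have hct := dd_supp hc ((1:ℝ), (0 : EuclideanSpace ℝ (Fin N)))
  have hddz : ∀ (ξ : ℝ × EuclideanSpace ℝ (Fin N) → ℝ), tsupport ξ ⊆ tsupport ζ →
      ∀ z, z.1 ∉ Ioo (0:ℝ) T → ξ z = 0 := by
    intro ξ hξ z hz
    exact image_eq_zero_of_notMem_tsupport fun h => hz (hs (hξ h))
  have hζ0 := hddz ζ subset_rfl
  have hts : ∀ v (ξ : ℝ × EuclideanSpace ℝ (Fin N) → ℝ), tsupport ξ ⊆ tsupport ζ →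
      tsupport (dd v ξ) ⊆ tsupport ζ :=
    fun v ξ hξ => (tsupport_fderiv_apply_subset ℝ v).trans hξ
  have hub : ∀ z : ℝ × EuclideanSpace ℝ (Fin N), |u z.1 z.2| ≤ C := fun z => by
    rw [abs_of_nonneg (hun _ _)]; exact hC _ _
  have Iu : ∀ ξ : ℝ × EuclideanSpace ℝ (Fin N) → ℝ, Continuous ξ → HasCompactSupport ξ →
      Integrable (fun z => u z.1 z.2 * ξ z) := fun ξ h1 h2 => bdd_integrable hum' hub h1 h2
  have hu0m' : Measurable (fun z : ℝ × EuclideanSpace ℝ (Fin N) => u0 z.2) := hu0m.comp measurable_snd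
  have Iu0 : Integrable (fun z : ℝ × EuclideanSpace ℝ (Fin N) =>
      u0 z.2 * dd ((1:ℝ), (0 : EuclideanSpace ℝ (Fin N))) ζ z) :=
    bdd_integrable (C := C0) hu0m' (fun z => by rw [abs_of_nonneg (hu0n _)]; exact hC0 _)
      hζt.continuous hct
  have Iw : Integrable (fun z : ℝ × EuclideanSpace ℝ (Fin N) => w z.2 * (u z.1 z.2) ^ q * ζ z) := by
    have : Integrable (fun z : ℝ × EuclideanSpace ℝ (Fin N) => (u z.1 z.2) ^ q * (w z.2 * ζ z)) := by
      refine bdd_integrable (C := C ^ q) (by fun_prop) (fun z => ?_)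
        (by have := hζ.continuous; fun_prop) hc.mul_left
      rw [abs_of_nonneg (Real.rpow_nonneg (hun _ _) _)]
      exact Real.rpow_le_rpow (hun _ _) (hC _ _) hq0.le
    refine this.congr (Eventually.of_forall fun z => ?_)
    simp only; ring
  have hu0z : ∫ z : ℝ × EuclideanSpace ℝ (Fin N),
      u0 z.2 * dd ((1:ℝ), (0 : EuclideanSpace ℝ (Fin N))) ζ z = 0 := by
    rw [Measure.volume_eq_prod] at Iu0 ⊢
    rw [integral_prod_symm _ Iu0]
    have : ∀ x, ∫ s : ℝ, u0 x * dd ((1:ℝ), (0 : EuclideanSpace ℝ (Fin N))) ζ (s, x) = 0 := by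
      intro x
      rw [integral_const_mul]
      have hcl : IsClosedEmbedding (fun s : ℝ => (s, x)) := by
        refine ⟨isEmbedding_prodMkLeft x, ?_⟩
        have : range (fun s : ℝ => (s, x)) = Prod.snd ⁻¹' {x} := by
          ext ⟨a, b⟩; simp [eq_comm]
        rw [this]
        exact isClosed_singleton.preimage continuous_snd
      rw [integral_eq_zero_of_hasDerivAt_of_integrable (f := fun s => ζ (s, x)), mul_zero]
      · intro s
        have h1 : HasFDerivAt ζ (fderiv ℝ ζ (s, x)) (s, x) :=
          (hζ.differentiable (by simp) _).hasFDerivAt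
        have h2 : HasDerivAt (fun s : ℝ => (s, x)) ((1:ℝ), (0 : EuclideanSpace ℝ (Fin N))) s :=
          (hasDerivAt_id s).prodMk (hasDerivAt_const s x)
        exact h1.comp_hasDerivAt s h2
      · exact (hζt.continuous.comp hcl.continuous).integrable_of_hasCompactSupport
          (hct.comp_isClosedEmbedding hcl)
      · exact (hζ.continuous.comp hcl.continuous).integrable_of_hasCompactSupport
          (hc.comp_isClosedEmbedding hcl)
    simp [this]
  have Ig : ∀ i, Integrable (fun z : ℝ × EuclideanSpace ℝ (Fin N) =>
      g z.1 z.2 i * dd ((0:ℝ), EuclideanSpace.single i (1:ℝ)) ζ z) := fun i =>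
    g_integrable hg hg2 (dd_contDiff hζ _).continuous (dd_supp hc _)
      (hddz _ (hts _ _ subset_rfl)) i
  have hgrad : ∀ i, ∫ z : ℝ × EuclideanSpace ℝ (Fin N),
      g z.1 z.2 i * dd ((0:ℝ), EuclideanSpace.single i (1:ℝ)) ζ z
      = - ∫ z, u z.1 z.2 * dd ((0:ℝ), EuclideanSpace.single i (1:ℝ))
        (dd ((0:ℝ), EuclideanSpace.single i (1:ℝ)) ζ) z := by
    intro i
    set ξ := dd ((0:ℝ), EuclideanSpace.single i (1:ℝ)) ζ with hξ
    have hξs := dd_contDiff hζ ((0:ℝ), EuclideanSpace.single i (1:ℝ))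
    have hξc := dd_supp hc ((0:ℝ), EuclideanSpace.single i (1:ℝ))
    have hξ0 := hddz ξ (hts _ _ subset_rfl)
    have := H1 ξ (hξs.of_le (by exact_mod_cast le_top)) hξc (fun s x h => hξ0 (s, x) h) i
    simp only [Real.rpow_one] at this
    have e1 := iter_eq (T := T) (F := fun z => u z.1 z.2 * dd ((0:ℝ), EuclideanSpace.single i (1:ℝ)) ξ z)
      (Iu _ (dd_contDiff hξs _).continuous (dd_supp hξc _))
      (fun z hz => by
        simp only [hddz (dd _ ξ) (hts _ _ (hts _ _ subset_rfl)) z hz, mul_zero])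
    have e2 := iter_eq (T := T) (F := fun z => g z.1 z.2 i * ξ z) (Ig i)
      (fun z hz => by simp only [hξ0 z hz, mul_zero])
    rw [← e1, ← e2]
    simp only [dd] at this ⊢
    linarith
  have hw2 := H2 ζ (hζ.of_le (by exact_mod_cast le_top)) hc
    (fun s x h => hζ0 (s, x) (fun h' => absurd h'.2 (not_lt.2 h)))
  have hpt : ∀ s x, ((u0 x - u s x) * fderiv ℝ ζ (s, x) (1, 0)
              + fderiv ℝ ζ (s, x) (0, g s x)
              + w x * (u s x) ^ q * ζ (s, x)) =
      u0 x * dd ((1:ℝ), (0 : EuclideanSpace ℝ (Fin N))) ζ (s, x)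
       - u s x * dd ((1:ℝ), (0 : EuclideanSpace ℝ (Fin N))) ζ (s, x)
       + ∑ i, g s x i * dd ((0:ℝ), EuclideanSpace.single i (1:ℝ)) ζ (s, x)
       + w x * (u s x) ^ q * ζ (s, x) := by
    intro s x
    have e : ((0:ℝ), g s x) = ∑ i, g s x i • ((0:ℝ), EuclideanSpace.single i (1:ℝ)) := by
      have h := (EuclideanSpace.basisFun (Fin N) ℝ).sum_repr (g s x)
      simp only [EuclideanSpace.basisFun_repr, EuclideanSpace.basisFun_apply] at h
      refine Prod.ext ?_ ?_
      · simp [Prod.fst_sum]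
      · rw [Prod.snd_sum]; exact h.symm
    have e2 : fderiv ℝ ζ (s, x) (0, g s x) =
        ∑ i, g s x i * dd ((0:ℝ), EuclideanSpace.single i (1:ℝ)) ζ (s, x) := by
      rw [e, map_sum]
      simp only [map_smul, smul_eq_mul, dd]
    rw [e2]; simp only [dd]; ring
  simp only [hpt] at hw2
  have Isum : Integrable (fun z : ℝ × EuclideanSpace ℝ (Fin N) =>
      ∑ i, g z.1 z.2 i * dd ((0:ℝ), EuclideanSpace.single i (1:ℝ)) ζ z) :=
    integrable_finsetSum _ fun i _ => Ig i
  have It := Iu _ hζt.continuous hct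
  have e := iter_eq (T := T) (F := fun z => u0 z.2 * dd ((1:ℝ), (0 : EuclideanSpace ℝ (Fin N))) ζ z
       - u z.1 z.2 * dd ((1:ℝ), (0 : EuclideanSpace ℝ (Fin N))) ζ z
       + ∑ i, g z.1 z.2 i * dd ((0:ℝ), EuclideanSpace.single i (1:ℝ)) ζ z
       + w z.2 * (u z.1 z.2) ^ q * ζ z) (((Iu0.sub It).add Isum).add Iw)
       (fun z hz => by
        have a1 := hddz (dd ((1:ℝ), (0 : EuclideanSpace ℝ (Fin N))) ζ) (hts _ _ subset_rfl) z hz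
        have a2 : ∀ i, dd ((0:ℝ), EuclideanSpace.single i (1:ℝ)) ζ z = 0 := fun i =>
          hddz (dd ((0:ℝ), EuclideanSpace.single i (1:ℝ)) ζ) (hts _ _ subset_rfl) z hz
        simp [a1, a2, hζ0 z hz])
  simp only at e
  rw [hw2] at e
  have Isub : Integrable (fun z : ℝ × EuclideanSpace ℝ (Fin N) =>
      u0 z.2 * dd ((1:ℝ), (0 : EuclideanSpace ℝ (Fin N))) ζ z
       - u z.1 z.2 * dd ((1:ℝ), (0 : EuclideanSpace ℝ (Fin N))) ζ z) := Iu0.sub It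
  have Iadd : Integrable (fun z : ℝ × EuclideanSpace ℝ (Fin N) =>
      u0 z.2 * dd ((1:ℝ), (0 : EuclideanSpace ℝ (Fin N))) ζ z
       - u z.1 z.2 * dd ((1:ℝ), (0 : EuclideanSpace ℝ (Fin N))) ζ z
       + ∑ i, g z.1 z.2 i * dd ((0:ℝ), EuclideanSpace.single i (1:ℝ)) ζ z) := Isub.add Isum
  rw [integral_add Iadd Iw, integral_add Isub Isum,
    integral_sub Iu0 It, hu0z, integral_finsetSum _ fun i _ => Ig i] at e
  simp only [hgrad, Finset.sum_neg_distrib] at e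
  linarith

instance volHaar (N : ℕ) : (volume : Measure (ℝ × EuclideanSpace ℝ (Fin N))).IsAddHaarMeasure :=
  Measure.prod.instIsAddHaarMeasure (volume : Measure ℝ) (volume : Measure (EuclideanSpace ℝ (Fin N)))

lemma step_eps {N : ℕ} (hN : 1 ≤ N) {q σ β : ℝ} (hq0 : 0 < q) (hq1 : q < 1) (hσ0 : 0 < σ)
    (hβ : β * (1 + σ / 2) = 1 - q)
    {u0 : EuclideanSpace ℝ (Fin N) → ℝ} (hu0 : IsBddNonneg N u0)
    {u : ℝ → EuclideanSpace ℝ (Fin N) → ℝ}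
    (hu : IsWeakSolution N 1 q (fun x => ‖x‖ ^ σ) u0 u) {R : ℝ}
    (hR : ∀ᵐ z : ℝ × EuclideanSpace ℝ (Fin N), 0 < z.1 → R ≤ ‖z.2‖ → u z.1 z.2 = 0)
    {t0 M : ℝ} (ht0 : 0 ≤ t0) (hM : 0 < M)
    (huM : ∀ᵐ z : ℝ × EuclideanSpace ℝ (Fin N), t0 < z.1 → u z.1 z.2 ≤ M)
    (φ : ContDiffBump (0 : ℝ × EuclideanSpace ℝ (Fin N))) (hφ : φ.rOut ≤ M ^ (β / 2))
    (t : ℝ) (ht : t0 + 2 * φ.rOut ≤ t) (x : EuclideanSpace ℝ (Fin N)) :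
    cv volume (fun z => u z.1 z.2) (φ.normed volume) (t, x)
      ≤ 2 * M * Real.exp (-(M ^ (-β) / 32 / 2 * (t - (t0 + 2 * φ.rOut)))) := by
  set ε := φ.rOut with hε
  have hεpos : 0 < ε := φ.rOut_pos
  set ρ := φ.normed volume with hρ
  have hρs : ContDiff ℝ (⊤ : ℕ∞) ρ := φ.contDiff_normed
  have hρc : HasCompactSupport ρ := φ.hasCompactSupport_normed
  have hρn : ∀ z, 0 ≤ ρ z := φ.nonneg_normed
  have hρ1 : ∫ z, ρ z = 1 := φ.integral_normed
  have hball : ∀ p z : ℝ × EuclideanSpace ℝ (Fin N), ρ (p - z) ≠ 0 →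
      |p.1 - z.1| < ε ∧ ‖p.2 - z.2‖ < ε := by
    intro p z h
    have : p - z ∈ Function.support ρ := h
    rw [hρ, φ.support_normed_eq, mem_ball_zero_iff, Prod.norm_def, max_lt_iff] at this
    exact this
  have hu' := hu
  obtain ⟨hum, hun, ⟨C, hC⟩, -⟩ := hu'
  have hum' : Measurable (fun z : ℝ × EuclideanSpace ℝ (Fin N) => u z.1 z.2) := hum
  have hub : ∀ z : ℝ × EuclideanSpace ℝ (Fin N), |u z.1 z.2| ≤ C := fun z => by
    rw [abs_of_nonneg (hun _ _)]; exact hC _ _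
  have hloc : LocallyIntegrable (fun z : ℝ × EuclideanSpace ℝ (Fin N) => u z.1 z.2) volume := by
    refine (locallyIntegrable_const C).mono hum'.aestronglyMeasurable (Eventually.of_forall fun z => ?_)
    exact (hub z).trans (le_abs_self C)
  have hζs : ∀ p : ℝ × EuclideanSpace ℝ (Fin N), ContDiff ℝ (⊤ : ℕ∞) (fun z => ρ (p - z)) :=
    fun p => hρs.comp (contDiff_const.sub contDiff_id)
  have hζc : ∀ p : ℝ × EuclideanSpace ℝ (Fin N), HasCompactSupport (fun z => ρ (p - z)) :=
    fun p => hρc.comp_isClosedEmbedding (Homeomorph.subLeft p).isClosedEmbedding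
  have hw : Continuous (fun x : EuclideanSpace ℝ (Fin N) => ‖x‖ ^ σ) :=
    continuous_norm.rpow_const fun _ => Or.inr hσ0.le
  have IU : ∀ p : ℝ × EuclideanSpace ℝ (Fin N), Integrable (fun z => u z.1 z.2 * ρ (p - z)) :=
    fun p => bdd_integrable hum' hub (hζs p).continuous (hζc p)
  set S : EuclideanSpace ℝ (Fin N) → ℝ := fun x => M ^ (q - 1) * (max (‖x‖ - ε) 0) ^ σ with hS
  have hSn : ∀ x, 0 ≤ S x := fun x => by positivity
  have hcmp := comparison (N := N) (U := cv volume (fun z => u z.1 z.2) ρ)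
    (Ut := cv volume (fun z => u z.1 z.2) (dd ((1:ℝ), (0 : EuclideanSpace ℝ (Fin N))) ρ))
    (Ui := fun i => cv volume (fun z => u z.1 z.2) (dd ((0:ℝ), EuclideanSpace.single i (1:ℝ)) ρ))
    (Uii := fun i => cv volume (fun z => u z.1 z.2) (dd ((0:ℝ), EuclideanSpace.single i (1:ℝ))
      (dd ((0:ℝ), EuclideanSpace.single i (1:ℝ)) ρ)))
    (S := S) (M := M) (k := M ^ (-β) / 32) (t1 := t0 + 2 * ε) (R := R + ε) hM
    (cv_continuous volume hloc hρs hρc)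
    (fun p => by simpa using cv_hasDerivAt volume hloc hρs hρc p ((1:ℝ), (0 : EuclideanSpace ℝ (Fin N))) 0)
    (fun i p r => cv_hasDerivAt volume hloc hρs hρc p _ r)
    (fun i p => by
      simpa using cv_hasDerivAt volume hloc (dd_contDiff hρs _) (dd_supp hρc _) p
        ((0:ℝ), EuclideanSpace.single i (1:ℝ)) 0)
    ?_ ?_ hSn ?_ ?_ t ht x
  · refine hcmp.trans ?_
    have hk : 0 ≤ M ^ (-β) / 32 := by positivity
    have hE : Real.exp (-(M ^ (-β) / 32 * ‖x‖ ^ 2)) ≤ 1 :=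
      Real.exp_le_one_iff.2 (by have : 0 ≤ M ^ (-β) / 32 * ‖x‖ ^ 2 := by positivity
                                linarith)
    have hD : 0 ≤ M * Real.exp (-(M ^ (-β) / 32 / 2 * (t - (t0 + 2 * ε)))) := by positivity
    nlinarith
  · -- bound by M
    intro t x ht
    have h1 : ∫ z, M * ρ ((t, x) - z) = M := by
      rw [integral_const_mul, integral_sub_left_eq_self ρ volume (t, x), hρ1, mul_one]
    rw [cv]
    calc _ ≤ ∫ z, M * ρ ((t, x) - z) := by
          refine integral_mono_ae (IU _) (((hζs _).continuous.integrable_of_hasCompactSupport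
            (hζc _)).const_mul M) ?_
          filter_upwards [huM] with z hz
          by_cases h : ρ ((t, x) - z) = 0
          · simp [h]
          · have := (abs_lt.1 (hball _ _ h).1)
            simp only at this
            exact mul_le_mul_of_nonneg_right (hz (by linarith)) (hρn _)
      _ = M := h1
  · intro t x ht hx
    rw [cv]
    refine integral_eq_zero_of_ae ?_
    filter_upwards [hR] with z hz
    by_cases h : ρ ((t, x) - z) = 0
    · simp [h]
    · obtain ⟨h1, h2⟩ := hball _ _ h
      have h1 := abs_lt.1 h1
      simp only at h1 h2
      have h3 := norm_sub_norm_le x z.2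
      simp [hz (by linarith) (by linarith)]
  · intro t x ht
    have hsub : tsupport (fun z => ρ ((t, x) - z)) ⊆ {z | z.1 ∈ Ioo (0:ℝ) (t + ε + 1)} := by
      have h1 : tsupport (fun z => ρ ((t, x) - z)) ⊆ {z | z.1 ∈ Icc (t - ε) (t + ε)} := by
        refine closure_minimal (fun z hz => ?_) (isClosed_Icc.preimage continuous_fst)
        have h1 := abs_lt.1 (hball _ _ hz).1
        simp only at h1
        exact ⟨by linarith, by linarith⟩
      refine h1.trans fun z hz => ?_
      obtain ⟨a, b⟩ := hz
      exact ⟨by linarith, by linarith⟩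
    have hdist := weak_to_dist hq0 hw hu0 hu (T := t + ε + 1) (by linarith) (hζs (t, x)) (hζc (t, x)) hsub
    simp only [dd_dd_comp_sub hρs] at hdist
    simp only [dd_comp_sub hρs, mul_neg, integral_neg] at hdist
    have hkey : S x * cv volume (fun z => u z.1 z.2) ρ (t, x)
        ≤ ∫ z : ℝ × EuclideanSpace ℝ (Fin N), ‖z.2‖ ^ σ * u z.1 z.2 ^ q * ρ ((t, x) - z) := by
      rw [cv, ← integral_const_mul]
      refine integral_mono_ae ((IU _).const_mul _) ?_ ?_
      · have : Integrable (fun z : ℝ × EuclideanSpace ℝ (Fin N) =>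
            (u z.1 z.2) ^ q * (‖z.2‖ ^ σ * ρ ((t, x) - z))) := by
          refine bdd_integrable (C := C ^ q) (by fun_prop) (fun z => ?_)
            ((hw.comp continuous_snd).mul (hζs (t, x)).continuous) (hζc (t, x)).mul_left
          rw [abs_of_nonneg (Real.rpow_nonneg (hun _ _) _)]
          exact Real.rpow_le_rpow (hun _ _) (hC _ _) hq0.le
        refine this.congr (Eventually.of_forall fun z => ?_)
        simp only; ring
      · filter_upwards [huM] with z hz
        by_cases h : ρ ((t, x) - z) = 0
        · simp [h]
        obtain ⟨h1, h2⟩ := hball _ _ h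
        have h1 := abs_lt.1 h1
        simp only at h1 h2
        have hzM := hz (by linarith)
        rw [← mul_assoc]
        refine mul_le_mul_of_nonneg_right ?_ (hρn _)
        have h3 := norm_sub_norm_le x z.2
        have h4 : (max (‖x‖ - ε) 0) ^ σ ≤ ‖z.2‖ ^ σ :=
          Real.rpow_le_rpow (le_max_right _ _) (max_le (by linarith) (norm_nonneg _)) hσ0.le
        have h5 : M ^ (q - 1) * u z.1 z.2 ≤ u z.1 z.2 ^ q := by
          rcases (hun z.1 z.2).eq_or_lt with h0 | h0
          · rw [← h0]; simp [Real.zero_rpow hq0.ne']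
          · have e : u z.1 z.2 ^ q = u z.1 z.2 ^ (q - 1) * u z.1 z.2 := by
              rw [← Real.rpow_add_one h0.ne']; congr 1; ring
            rw [e]
            exact mul_le_mul_of_nonneg_right
              (Real.rpow_le_rpow_of_nonpos h0 hzM (by linarith)) h0.le
        calc S x * u z.1 z.2 = (max (‖x‖ - ε) 0) ^ σ * (M ^ (q - 1) * u z.1 z.2) := by
              simp only [hS]; ring
          _ ≤ ‖z.2‖ ^ σ * u z.1 z.2 ^ q :=
              mul_le_mul h4 h5 (mul_nonneg (by positivity) (hun _ _)) (by positivity)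
    simp only [cv] at hkey ⊢
    linarith
  · intro x
    refine barrier_ineq (n := (N : ℝ)) (by positivity) (by positivity) rfl
      (by exact_mod_cast hN) (hSn x) ?_
    intro hx
    set b := M ^ (β / 2) with hb
    have hbpos : 0 < b := by positivity
    have hb2 : M ^ (-β) * b ^ 2 = 1 := by
      rw [hb, ← Real.rpow_natCast, ← Real.rpow_mul hM.le, ← Real.rpow_add hM]
      convert Real.rpow_zero M using 2
      push_cast; ring
    have hx2 : 2 * b ≤ ‖x‖ := by
      have h1 : 4 * b ^ 2 ≤ ‖x‖ ^ 2 := by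
        have h2 : 1 / 8 * b ^ 2 ≤ M ^ (-β) / 32 * ‖x‖ ^ 2 * b ^ 2 :=
          mul_le_mul_of_nonneg_right hx (by positivity)
        have h3 : M ^ (-β) / 32 * ‖x‖ ^ 2 * b ^ 2 = (M ^ (-β) * b ^ 2) * ‖x‖ ^ 2 / 32 := by ring
        rw [h3, hb2] at h2
        linarith
      refine le_of_sq_le_sq ?_ (norm_nonneg _)
      linarith [show (2 * b) ^ 2 = 4 * b ^ 2 by ring]
    have h1 : b ^ σ ≤ (max (‖x‖ - ε) 0) ^ σ :=
      Real.rpow_le_rpow hbpos.le (le_max_of_le_left (by linarith)) hσ0.le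
    have h2 : M ^ (q - 1) * b ^ σ = M ^ (-β) := by
      rw [hb, ← Real.rpow_mul hM.le, ← Real.rpow_add hM]
      congr 1
      linarith
    have h3 : M ^ (-β) ≤ S x := by
      rw [← h2]; exact mul_le_mul_of_nonneg_left h1 (by positivity)
    have : 0 < M ^ (-β) := by positivity
    linarith

lemma step {N : ℕ} (hN : 1 ≤ N) {q σ β : ℝ} (hq0 : 0 < q) (hq1 : q < 1) (hσ0 : 0 < σ)
    (hβ : β * (1 + σ / 2) = 1 - q)
    {u0 : EuclideanSpace ℝ (Fin N) → ℝ} (hu0 : IsBddNonneg N u0)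
    {u : ℝ → EuclideanSpace ℝ (Fin N) → ℝ}
    (hu : IsWeakSolution N 1 q (fun x => ‖x‖ ^ σ) u0 u) {R : ℝ}
    (hR : ∀ᵐ z : ℝ × EuclideanSpace ℝ (Fin N), 0 < z.1 → R ≤ ‖z.2‖ → u z.1 z.2 = 0)
    {t0 M : ℝ} (ht0 : 0 ≤ t0) (hM : 0 < M)
    (huM : ∀ᵐ z : ℝ × EuclideanSpace ℝ (Fin N), t0 < z.1 → u z.1 z.2 ≤ M) :
    ∀ᵐ z : ℝ × EuclideanSpace ℝ (Fin N), t0 + 128 * M ^ β < z.1 → u z.1 z.2 ≤ M / 2 := by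
  have hr : ∀ n : ℕ, (0:ℝ) < 1 / ((n:ℝ) + 1) := fun n => Nat.one_div_pos_of_nat
  set φ : ℕ → ContDiffBump (0 : ℝ × EuclideanSpace ℝ (Fin N)) := fun n =>
    ⟨1 / ((n:ℝ) + 1), 2 * (1 / ((n:ℝ) + 1)), hr n, by linarith [hr n]⟩ with hφ
  have hlim : Tendsto (fun n => (φ n).rOut) atTop (𝓝 0) := by
    have := (tendsto_one_div_add_atTop_nhds_zero_nat (𝕜 := ℝ)).const_mul 2
    rw [mul_zero] at this
    exact this
  obtain ⟨hum, hun, ⟨C, hC⟩, -⟩ := id hu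
  have hum' : Measurable (fun z : ℝ × EuclideanSpace ℝ (Fin N) => u z.1 z.2) := hum
  have hloc : LocallyIntegrable (fun z : ℝ × EuclideanSpace ℝ (Fin N) => u z.1 z.2) volume := by
    refine (locallyIntegrable_const C).mono hum'.aestronglyMeasurable (Eventually.of_forall fun z => ?_)
    rw [Real.norm_of_nonneg (hun _ _)]
    exact (hC _ _).trans (le_abs_self C)
  have hae := ContDiffBump.ae_convolution_tendsto_right_of_locallyIntegrable (μ := volume)
    (φ := φ) (K := 2) hlim (Eventually.of_forall fun n => le_rfl) hloc
  filter_upwards [hae] with z hz hzt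
  refine le_of_tendsto hz ?_
  have e1 : ∀ᶠ n in atTop, (φ n).rOut < M ^ (β / 2) := hlim.eventually_lt_const (by positivity)
  have e2 : ∀ᶠ n in atTop, (φ n).rOut < (z.1 - (t0 + 128 * M ^ β)) / 2 :=
    hlim.eventually_lt_const (by linarith)
  filter_upwards [e1, e2] with n h1 h2
  have hMβ : 0 < M ^ β := by positivity
  have := step_eps hN hq0 hq1 hσ0 hβ hu0 hu hR ht0 hM huM (φ n) h1.le z.1 (by linarith) z.2
  have e : ((φ n).normed volume ⋆[ContinuousLinearMap.lsmul ℝ ℝ, volume]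
      (fun z : ℝ × EuclideanSpace ℝ (Fin N) => u z.1 z.2)) z
      = cv volume (fun z => u z.1 z.2) ((φ n).normed volume) (z.1, z.2) := by
    rw [convolution_lsmul_swap, cv]
    simp only [smul_eq_mul, mul_comm]
  rw [e]
  refine this.trans ?_
  have hinv : M ^ (-β) * M ^ β = 1 := by
    rw [← Real.rpow_add hM]; simp
  have hexp : (2:ℝ) ≤ M ^ (-β) / 32 / 2 * (z.1 - (t0 + 2 * (φ n).rOut)) := by
    have : M ^ (-β) / 32 / 2 * (128 * M ^ β) ≤ M ^ (-β) / 32 / 2 * (z.1 - (t0 + 2 * (φ n).rOut)) :=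
      mul_le_mul_of_nonneg_left (by linarith) (by positivity)
    nlinarith
  have h4 : Real.exp (-(M ^ (-β) / 32 / 2 * (z.1 - (t0 + 2 * (φ n).rOut)))) ≤ 1 / 4 := by
    calc _ ≤ Real.exp (-2) := Real.exp_le_exp.2 (by linarith)
      _ ≤ 1 / 4 := by
        rw [Real.exp_neg, inv_le_comm₀ (Real.exp_pos _) (by norm_num)]
        have h1 := Real.exp_one_gt_d9
        have h2 : Real.exp 2 = Real.exp 1 * Real.exp 1 := by rw [← Real.exp_add]; norm_num
        rw [h2]; norm_num; nlinarith
  nlinarith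

end FTE

/-- **Finite time extinction in the semilinear case `m = 1`.**
Let `N ≥ 1`, `q ∈ (0,1)` and `σ > 0` arbitrary. Let `u₀ ∈ L^∞(ℝᴺ)` be non-negative
and let `u` be a non-negative weak solution of `∂ₜ u = Δu − |x|^σ u^q` with
`u(0) = u₀`, whose support is localized in some ball `B(0,R)`.
Then `u` vanishes in finite time. -/
theorem finite_time_extinction_semilinear
    (N : ℕ) (hN : 1 ≤ N) (q σ : ℝ) (hq0 : 0 < q) (hq1 : q < 1) (hσ0 : 0 < σ)
    (u0 : EuclideanSpace ℝ (Fin N) → ℝ) (hu0 : IsBddNonneg N u0)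
    (u : ℝ → EuclideanSpace ℝ (Fin N) → ℝ)
    (hu : IsWeakSolution N 1 q (fun x => ‖x‖ ^ σ) u0 u)
    (hloc : ∃ R : ℝ, 0 < R ∧ SupportLocalized N R u) :
    VanishesInFiniteTime N u := by
  obtain ⟨R, -, hsupp⟩ := hloc
  obtain ⟨hum, hun, ⟨C, hC⟩, -⟩ := id hu
  have hum' : Measurable (fun z : ℝ × EuclideanSpace ℝ (Fin N) => u z.1 z.2) := hum
  have hR : ∀ᵐ z : ℝ × EuclideanSpace ℝ (Fin N), 0 < z.1 → R ≤ ‖z.2‖ → u z.1 z.2 = 0 := by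
    have hms : MeasurableSet {z : ℝ × EuclideanSpace ℝ (Fin N) |
        0 < z.1 → R ≤ ‖z.2‖ → u z.1 z.2 = 0} := by
      have h1 : MeasurableSet {z : ℝ × EuclideanSpace ℝ (Fin N) | 0 < z.1} :=
        measurableSet_lt measurable_const measurable_fst
      have h2 : MeasurableSet {z : ℝ × EuclideanSpace ℝ (Fin N) | R ≤ ‖z.2‖} :=
        measurableSet_le measurable_const measurable_snd.norm
      have h3 : MeasurableSet {z : ℝ × EuclideanSpace ℝ (Fin N) | u z.1 z.2 = 0} :=
        hum' (measurableSet_singleton 0)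
      exact h1.imp (h2.imp h3)
    have := (Measure.ae_prod_mem_iff_ae_ae_mem (μ := (volume : Measure ℝ))
      (ν := (volume : Measure (EuclideanSpace ℝ (Fin N)))) hms).2 (by
        filter_upwards [hsupp] with t ht
        by_cases h : 0 < t
        · filter_upwards [ht h] with x hx _ using hx
        · exact Filter.Eventually.of_forall fun x h' => absurd h' h)
    exact this
  set β := (1 - q) / (1 + σ / 2) with hβd
  have hσ1 : 0 < 1 + σ / 2 := by linarith
  have hβ : β * (1 + σ / 2) = 1 - q := div_mul_cancel₀ _ hσ1.ne'
  have hβpos : 0 < β := div_pos (by linarith) hσ1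
  set M := max C 1 with hM
  have hMpos : 0 < M := lt_of_lt_of_le one_pos (le_max_right _ _)
  set r : ℝ := (1 / 2 : ℝ) ^ β with hr
  have hr0 : 0 < r := by positivity
  have hr1 : r < 1 := Real.rpow_lt_one (by norm_num) (by norm_num) hβpos
  have hind : ∀ n : ℕ, ∀ᵐ z : ℝ × EuclideanSpace ℝ (Fin N),
      128 * M ^ β * ∑ i ∈ Finset.range n, r ^ i < z.1 → u z.1 z.2 ≤ M * (1 / 2) ^ n := by
    intro n
    induction n with
    | zero =>
      refine Filter.Eventually.of_forall fun z _ => ?_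
      have h : u z.1 z.2 ≤ M := (hC z.1 z.2).trans (le_max_left _ _)
      simpa only [pow_zero, mul_one] using h
    | succ n ih =>
      have h := FTE.step hN hq0 hq1 hσ0 hβ hu0 hu hR
        (mul_nonneg (by positivity) (Finset.sum_nonneg fun i _ => by positivity))
        (by positivity : 0 < M * (1 / 2) ^ n) ih
      have e : (M * (1 / 2) ^ n) ^ β = M ^ β * r ^ n := by
        rw [Real.mul_rpow hMpos.le (by positivity), hr, ← Real.rpow_natCast, ← Real.rpow_natCast,
          ← Real.rpow_mul (by norm_num), ← Real.rpow_mul (by norm_num), mul_comm β]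
      filter_upwards [h] with z hz hzt
      rw [Finset.sum_range_succ] at hzt
      refine (hz ?_).trans (le_of_eq (by ring))
      rw [e]; linarith
  refine ⟨128 * M ^ β * (1 - r)⁻¹ + 1, ?_, ?_⟩
  · have : 0 < (1 - r)⁻¹ := inv_pos.2 (by linarith)
    positivity
  have hall : ∀ᵐ z : ℝ × EuclideanSpace ℝ (Fin N),
      128 * M ^ β * (1 - r)⁻¹ + 1 ≤ z.1 → u z.1 z.2 = 0 := by
    filter_upwards [ae_all_iff.2 hind] with z hz hzt
    refine le_antisymm ?_ (hun _ _)
    have hlim : Filter.Tendsto (fun n : ℕ => M * (1 / 2 : ℝ) ^ n) Filter.atTop (nhds 0) := by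
      simpa using (tendsto_pow_atTop_nhds_zero_of_lt_one (by norm_num : (0:ℝ) ≤ 1 / 2)
        (by norm_num)).const_mul M
    refine ge_of_tendsto' hlim fun n => hz n ?_
    have hs : ∑ i ∈ Finset.range n, r ^ i ≤ (1 - r)⁻¹ := by
      rw [← tsum_geometric_of_lt_one hr0.le hr1]
      exact (summable_geometric_of_lt_one hr0.le hr1).sum_le_tsum _ (fun i _ => by positivity)
    have : 128 * M ^ β * ∑ i ∈ Finset.range n, r ^ i ≤ 128 * M ^ β * (1 - r)⁻¹ :=
      mul_le_mul_of_nonneg_left hs (by positivity)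
    linarith
  have h2 := Measure.ae_ae_of_ae_prod (μ := (volume : Measure ℝ))
    (ν := (volume : Measure (EuclideanSpace ℝ (Fin N)))) hall
  filter_upwards [h2] with t ht htT
  filter_upwards [ht] with x hx using hx htT
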